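/- Let two circles in the plane ℝ² have centers (x₁, y₁), (x₂, y₂) and radii r₁, r₂ > 0, and suppose they are externally tangent: the distance between the centers equals r₁ + r₂. Set βᵢ = 1/rᵢ, ẋᵢ = xᵢ/rᵢ, ẏᵢ = yᵢ/rᵢ. Then the triple a = β₁ẋ₂ − β₂ẋ₁, b = β₁ẏ₂ − β₂ẏ₁, c = β₁ + β₂ satisfies a² + b² = c². -/

import Mathlib

/-- A pair of externally tangent disks in the plane gives rise to a Pythagorean
triple `(a, b, c) = (β₁ẋ₂ − β₂ẋ₁, β₁ẏ₂ − β₂ẏ₁, β₁ + β₂)` built from the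
curvatures and reduced center coordinates. -/
theorem pythagorean_triple_of_tangent_disks
    (x₁ y₁ x₂ y₂ r₁ r₂ : ℝ) (hr₁ : 0 < r₁) (hr₂ : 0 < r₂)
    (htan : Real.sqrt ((x₂ - x₁) ^ 2 + (y₂ - y₁) ^ 2) = r₁ + r₂)
    (β₁ β₂ dx₁ dy₁ dx₂ dy₂ a b c : ℝ)
    (hβ₁ : β₁ = 1 / r₁) (hβ₂ : β₂ = 1 / r₂)
    (hdx₁ : dx₁ = x₁ / r₁) (hdy₁ : dy₁ = y₁ / r₁)
    (hdx₂ : dx₂ = x₂ / r₂) (hdy₂ : dy₂ = y₂ / r₂)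
    (ha : a = β₁ * dx₂ - β₂ * dx₁)
    (hb : b = β₁ * dy₂ - β₂ * dy₁)
    (hc : c = β₁ + β₂) :
    a ^ 2 + b ^ 2 = c ^ 2 := by
  have h : (x₂ - x₁) ^ 2 + (y₂ - y₁) ^ 2 = (r₁ + r₂) ^ 2 := by
    rw [← htan, Real.sq_sqrt (by positivity)]
  have h1 : r₁ ≠ 0 := hr₁.ne'
  have h2 : r₂ ≠ 0 := hr₂.ne'
  have ea : a = (x₂ - x₁) / (r₁ * r₂) := by
    subst ha hβ₁ hβ₂ hdx₁ hdx₂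
    field_simp
  have eb : b = (y₂ - y₁) / (r₁ * r₂) := by
    subst hb hβ₁ hβ₂ hdy₁ hdy₂
    field_simp
  have ec : c = (r₁ + r₂) / (r₁ * r₂) := by
    subst hc hβ₁ hβ₂
    field_simp
    ring
  rw [ea, eb, ec, div_pow, div_pow, div_pow, ← add_div, h]
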